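/- Let w : [0, ∞) → ℝ be continuously differentiable with |w(x)| ≤ 1/c and |w′(x)| ≤ L for all x ≥ 0. Then for every φ ≥ 0 the map t ↦ Jw(t, φ) is differentiable on (0, ∞), and for every t > 0, |d/dt Jw(t, φ)| ≤ φ + 1 + 2λ/c + L ( φ((1/2)αC₁ t^{−1/2} + λ) + λ + (1/2)αC₁ t^{−1/2} ), where C₁ = √(2/π). -/

import Mathlib

open MeasureTheory Real

/-- Standard Gaussian density on ℝ. -/
noncomputable def gaussDensity (z : ℝ) : ℝ := Real.exp (-z ^ 2 / 2) / Real.sqrt (2 * Real.pi)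

/-- One-step update of the conditional odds process upon observing a normalized
increment `z` after a waiting time `t`, starting from odds `φ`. -/
noncomputable def jfun (lam alp t φ z : ℝ) : ℝ :=
  Real.exp (alp * z * Real.sqrt t + (lam - alp ^ 2 / 2) * t) * φ +
    ∫ u in (0:ℝ)..t, lam * Real.exp ((lam + alp * z / Real.sqrt t) * u - alp ^ 2 * u ^ 2 / (2 * t))


/-- Deterministic evolution of the odds process between observations. -/
noncomputable def varphi (lam t x : ℝ) : ℝ := Real.exp (lam * t) * (x + 1) - 1

/-- The averaging operator `K`: Gaussian expectation of `w` applied to the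
one-step odds update. -/
noncomputable def Kop (lam alp : ℝ) (w : ℝ → ℝ) (t φ : ℝ) : ℝ :=
  ∫ z : ℝ, w (jfun lam alp t φ z) * gaussDensity z

/-- The jump operator `J`: running cost until the next observation at time `t`,
plus the discounted continuation value after that observation. -/
noncomputable def Jop (lam alp c : ℝ) (w : ℝ → ℝ) (t φ : ℝ) : ℝ :=
  (∫ u in (0:ℝ)..t, Real.exp (-(lam * u)) * (varphi lam u φ - lam / c)) +
    (if 0 < t then Real.exp (-(lam * t)) * Kop lam alp w t φ else 0)

/-- The optimized jump operator `J₀ w(φ) = inf_{t ≥ 0} J w(t, φ)`. -/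
noncomputable def J0op (lam alp c : ℝ) (w : ℝ → ℝ) (φ : ℝ) : ℝ :=
  ⨅ t : Set.Ici (0:ℝ), Jop lam alp c w t φ

lemma gd_cont : Continuous gaussDensity := by unfold gaussDensity; fun_prop

lemma gd_nonneg (z : ℝ) : 0 ≤ gaussDensity z := by unfold gaussDensity; positivity

lemma gd_int : Integrable gaussDensity := by
  unfold gaussDensity
  refine Integrable.div_const ?_ _
  convert integrable_exp_neg_mul_sq (b := 1/2) (by norm_num) using 2
  ring_nf

lemma gd_total : ∫ z, gaussDensity z = 1 := by
  have h := integral_gaussian (1/2)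
  have h2 : ∀ z : ℝ, gaussDensity z = Real.exp (-(1/2) * z^2) / Real.sqrt (2 * Real.pi) := by
    intro z; unfold gaussDensity; ring_nf
  simp_rw [h2]
  rw [integral_div, h]
  have : Real.pi / (1/2) = 2 * Real.pi := by ring
  rw [this, div_self]
  positivity

lemma gd_shift (β z : ℝ) : Real.exp (β * z - β ^ 2 / 2) * gaussDensity z = gaussDensity (z - β) := by
  unfold gaussDensity
  rw [← mul_div_assoc, ← Real.exp_add]
  ring_nf

lemma gd_abs_int : Integrable (fun z => |z| * gaussDensity z) := by
  have h := (integrable_mul_exp_neg_mul_sq (b := 1/2) (by norm_num)).abs.div_const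
    (Real.sqrt (2 * Real.pi))
  refine h.congr (Filter.Eventually.of_forall fun z => ?_)
  simp only [abs_mul, Real.abs_exp]
  unfold gaussDensity
  ring_nf

lemma gd_abs : ∫ z, |z| * gaussDensity z = Real.sqrt (2 / Real.pi) := by
  have h1 : ∀ z : ℝ, |z| * gaussDensity z =
      (fun x : ℝ => x * Real.exp (-(1/2) * x ^ 2) / Real.sqrt (2 * Real.pi)) |z| := by
    intro z; simp only [sq_abs]; unfold gaussDensity; ring_nf
  simp_rw [h1]
  rw [integral_comp_abs (f := fun x : ℝ => x * Real.exp (-(1/2) * x ^ 2) / Real.sqrt (2 * Real.pi)),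
    integral_div]
  have h := integral_rpow_mul_exp_neg_mul_rpow (p := 2) (q := 1) (b := 1/2) (by norm_num)
    (by norm_num) (by norm_num)
  simp only [Real.rpow_one, Real.rpow_two] at h
  rw [h]
  norm_num
  have : Real.sqrt 2 * Real.sqrt 2 = 2 := Real.mul_self_sqrt (by norm_num)
  field_simp
  nlinarith

lemma gd_exp_int (B : ℝ) : Integrable (fun z => Real.exp (B * z) * gaussDensity z) := by
  have h := (gd_int.comp_sub_right B).const_mul (Real.exp (B ^ 2 / 2))
  refine h.congr (Filter.Eventually.of_forall fun z => ?_)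
  simp only
  rw [← gd_shift, ← mul_assoc, ← Real.exp_add]
  ring_nf

lemma gd_exp_abs_int (B : ℝ) : Integrable (fun z => Real.exp (B * |z|) * gaussDensity z) := by
  refine ((gd_exp_int B).add (gd_exp_int (-B))).mono'
    (Continuous.aestronglyMeasurable (by have := gd_cont; fun_prop))
    (Filter.Eventually.of_forall fun z => ?_)
  rw [Real.norm_eq_abs, abs_of_nonneg (mul_nonneg (Real.exp_pos _).le (gd_nonneg z))]
  simp only [Pi.add_apply]
  rw [← add_mul]
  refine mul_le_mul_of_nonneg_right ?_ (gd_nonneg z)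
  rcases abs_cases z with ⟨h, _⟩ | ⟨h, _⟩ <;> rw [h]
  · linarith [Real.exp_pos (-B * z)]
  · have : B * -z = -B * z := by ring
    rw [this]; linarith [Real.exp_pos (B * z)]

/-- Key tilted estimate. -/
lemma gd_tilt (P Q β : ℝ) :
    ∫ z, |P + Q * z| * (Real.exp (β * z - β ^ 2 / 2) * gaussDensity z) ≤
      |P + Q * β| + |Q| * Real.sqrt (2 / Real.pi) := by
  have h1 : ∫ z, |P + Q * z| * (Real.exp (β * z - β ^ 2 / 2) * gaussDensity z) =
      ∫ z, |(P + Q * β) + Q * z| * gaussDensity z := by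
    rw [← integral_sub_right_eq_self (fun z => |(P + Q * β) + Q * z| * gaussDensity z) β]
    refine integral_congr_ae (Filter.Eventually.of_forall fun z => ?_)
    simp only
    rw [gd_shift]
    ring_nf
  rw [h1, ← gd_abs]
  have hi : Integrable (fun z => |P + Q * β| * gaussDensity z + |Q| * (|z| * gaussDensity z)) :=
    (gd_int.const_mul _).add (gd_abs_int.const_mul _)
  have h2 : |P + Q * β| + |Q| * ∫ z, |z| * gaussDensity z =
      ∫ z, (|P + Q * β| * gaussDensity z + |Q| * (|z| * gaussDensity z)) := by
    rw [integral_add (gd_int.const_mul _) (gd_abs_int.const_mul _), integral_const_mul,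
      integral_const_mul, gd_total, mul_one]
  rw [h2]
  refine integral_mono_of_nonneg (Filter.Eventually.of_forall fun z => mul_nonneg (abs_nonneg _) (gd_nonneg z)) hi
    (Filter.Eventually.of_forall fun z => ?_)
  simp only
  have := abs_add_le (P + Q * β) (Q * z)
  rw [abs_mul] at this
  nlinarith [mul_le_mul_of_nonneg_right this (gd_nonneg z)]

noncomputable def GG (l a s v z : ℝ) : ℝ :=
  Real.exp (l * s ^ 2 * v + a * z * s * v - a ^ 2 * s ^ 2 * v ^ 2 / 2)

noncomputable def dG (l a s v z : ℝ) : ℝ :=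
  GG l a s v z * (2 * l * s * v + a * z * v - a ^ 2 * s * v ^ 2)

noncomputable def dH (l a s v z : ℝ) : ℝ :=
  2 * s * GG l a s v z + s ^ 2 * dG l a s v z

noncomputable def jt (l a φ s z : ℝ) : ℝ :=
  φ * GG l a s 1 z + l * ∫ v in (0:ℝ)..1, s ^ 2 * GG l a s v z

noncomputable def djt (l a φ s z : ℝ) : ℝ :=
  φ * dG l a s 1 z + l * ∫ v in (0:ℝ)..1, dH l a s v z

lemma GG_hasDeriv (l a s v z : ℝ) : HasDerivAt (fun s => GG l a s v z) (dG l a s v z) s := by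
  unfold dG GG
  apply HasDerivAt.exp
  have h1 : HasDerivAt (fun s : ℝ => s ^ 2) (2 * s) s := by simpa using hasDerivAt_pow 2 s
  have h2 := (((h1.const_mul l).mul_const v).add
    (((hasDerivAt_id s).const_mul (a * z)).mul_const v)).sub
    (((h1.const_mul (a ^ 2)).mul_const (v ^ 2)).div_const 2)
  refine h2.congr_deriv ?_
  ring

lemma H_hasDeriv (l a s v z : ℝ) :
    HasDerivAt (fun s => s ^ 2 * GG l a s v z) (dH l a s v z) s := by
  have h1 : HasDerivAt (fun s : ℝ => s ^ 2) (2 * s) s := by simpa using hasDerivAt_pow 2 s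
  exact h1.mul (GG_hasDeriv l a s v z)

lemma GG_bound {l a R s v z : ℝ} (hl : 0 < l) (ha : 0 < a) (hs : |s| ≤ R)
    (hv0 : 0 ≤ v) (hv1 : v ≤ 1) :
    GG l a s v z ≤ Real.exp (l * R ^ 2 + a * R * |z|) := by
  unfold GG
  apply Real.exp_le_exp.2
  have hR : 0 ≤ R := (abs_nonneg s).trans hs
  have h1 : s ^ 2 ≤ R ^ 2 := sq_le_sq' (by linarith [(abs_le.1 hs).1]) (abs_le.1 hs).2
  have h2 : l * s ^ 2 * v ≤ l * R ^ 2 := by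
    calc l * s ^ 2 * v ≤ l * R ^ 2 * 1 := by gcongr
      _ = _ := by ring
  have h3 : a * z * s * v ≤ a * R * |z| := by
    calc a * z * s * v ≤ |a * z * s * v| := le_abs_self _
      _ = a * |z| * |s| * v := by
        rw [abs_mul, abs_mul, abs_mul, abs_of_pos ha, abs_of_nonneg hv0]
      _ ≤ a * |z| * R * 1 := by gcongr
      _ = _ := by ring
  have h4 : 0 ≤ a ^ 2 * s ^ 2 * v ^ 2 / 2 := by positivity
  linarith

noncomputable def DD (l a R z : ℝ) : ℝ :=
  Real.exp (l * R ^ 2 + 2 * l * R + a ^ 2 * R) * Real.exp ((a * R + a) * |z|)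

lemma GG_boundD {l a R s v z : ℝ} (hl : 0 < l) (ha : 0 < a) (hs : |s| ≤ R)
    (hv0 : 0 ≤ v) (hv1 : v ≤ 1) : |GG l a s v z| ≤ DD l a R z := by
  have hR : 0 ≤ R := (abs_nonneg s).trans hs
  have hp : 0 ≤ GG l a s v z := by unfold GG; positivity
  rw [abs_of_nonneg hp]
  refine (GG_bound hl ha hs hv0 hv1).trans ?_
  unfold DD
  rw [← Real.exp_add]
  apply Real.exp_le_exp.2
  have : 0 ≤ 2 * l * R + a ^ 2 * R + a * |z| := by positivity
  linarith

lemma dG_bound {l a R s v z : ℝ} (hl : 0 < l) (ha : 0 < a) (hs : |s| ≤ R)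
    (hv0 : 0 ≤ v) (hv1 : v ≤ 1) : |dG l a s v z| ≤ DD l a R z := by
  have hR : 0 ≤ R := (abs_nonneg s).trans hs
  have hp : 0 ≤ GG l a s v z := by unfold GG; positivity
  unfold dG
  rw [abs_mul, abs_of_nonneg hp]
  have h1 : |2 * l * s * v + a * z * v - a ^ 2 * s * v ^ 2| ≤
      Real.exp (2 * l * R + a * |z| + a ^ 2 * R) := by
    have e1 : |2 * l * s * v| ≤ 2 * l * R := by
      rw [abs_mul, abs_mul, abs_of_nonneg hv0, abs_of_pos (by positivity : 0 < 2 * l)]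
      calc 2 * l * |s| * v ≤ 2 * l * R * 1 := by gcongr
        _ = _ := by ring
    have e2 : |a * z * v| ≤ a * |z| := by
      rw [abs_mul, abs_mul, abs_of_nonneg hv0, abs_of_pos ha]
      calc a * |z| * v ≤ a * |z| * 1 := by gcongr
        _ = _ := by ring
    have e3 : |a ^ 2 * s * v ^ 2| ≤ a ^ 2 * R := by
      rw [abs_mul, abs_mul, abs_of_nonneg (sq_nonneg v), abs_of_nonneg (sq_nonneg a)]
      calc a ^ 2 * |s| * v ^ 2 ≤ a ^ 2 * R * 1 ^ 2 := by gcongr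
        _ = _ := by ring
    have e4 := Real.add_one_le_exp (2 * l * R + a * |z| + a ^ 2 * R)
    have e5 := abs_sub (2 * l * s * v + a * z * v) (a ^ 2 * s * v ^ 2)
    have e6 := abs_add_le (2 * l * s * v) (a * z * v)
    linarith
  calc _ ≤ Real.exp (l * R ^ 2 + a * R * |z|) * Real.exp (2 * l * R + a * |z| + a ^ 2 * R) :=
        mul_le_mul (GG_bound hl ha hs hv0 hv1) h1 (abs_nonneg _) (Real.exp_pos _).le
    _ = _ := by
        unfold DD
        rw [← Real.exp_add, ← Real.exp_add]; ring_nf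

lemma dH_bound {l a R s v z : ℝ} (hl : 0 < l) (ha : 0 < a) (hs : |s| ≤ R)
    (hv0 : 0 ≤ v) (hv1 : v ≤ 1) : |dH l a s v z| ≤ (2 * R + R ^ 2) * DD l a R z := by
  have hR : 0 ≤ R := (abs_nonneg s).trans hs
  have h1 := GG_boundD (z := z) hl ha hs hv0 hv1
  have h2 := dG_bound (z := z) hl ha hs hv0 hv1
  have h3 : s ^ 2 ≤ R ^ 2 := sq_le_sq' (by linarith [(abs_le.1 hs).1]) (abs_le.1 hs).2
  unfold dH
  refine (abs_add_le _ _).trans ?_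
  rw [abs_mul, abs_mul, abs_mul, abs_of_nonneg (sq_nonneg s), abs_two, add_mul]
  gcongr

lemma DD_int (l a R : ℝ) : Integrable (fun z => DD l a R z * gaussDensity z) := by
  unfold DD
  simp_rw [mul_assoc]
  exact (gd_exp_abs_int _).const_mul _

lemma GG_cont (l a s : ℝ) : Continuous (fun p : ℝ × ℝ => GG l a s p.1 p.2) := by
  unfold GG; fun_prop

lemma dH_cont (l a s : ℝ) : Continuous (fun p : ℝ × ℝ => dH l a s p.1 p.2) := by
  unfold dH dG GG; fun_prop

lemma jt_cont (l a φ s : ℝ) : Continuous (fun z => jt l a φ s z) := by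
  unfold jt
  refine Continuous.add ?_ (continuous_const.mul ?_)
  · unfold GG; fun_prop
  · refine intervalIntegral.continuous_parametric_intervalIntegral_of_continuous' ?_ 0 1
    unfold GG Function.uncurry; fun_prop

lemma djt_cont (l a φ s : ℝ) : Continuous (fun z => djt l a φ s z) := by
  unfold djt
  refine Continuous.add ?_ (continuous_const.mul ?_)
  · unfold dG GG; fun_prop
  · refine intervalIntegral.continuous_parametric_intervalIntegral_of_continuous' ?_ 0 1
    unfold dH dG GG Function.uncurry; fun_prop

lemma jt_nonneg {l φ : ℝ} (a s z : ℝ) (hl : 0 < l) (hφ : 0 ≤ φ) : 0 ≤ jt l a φ s z := by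
  unfold jt
  have h : 0 ≤ ∫ v in (0:ℝ)..1, s ^ 2 * GG l a s v z :=
    intervalIntegral.integral_nonneg (by norm_num) (fun v _ => by unfold GG; positivity)
  have : 0 ≤ GG l a s 1 z := by unfold GG; positivity
  positivity

lemma ball_abs {s₀ s : ℝ} (h : s ∈ Metric.ball s₀ 1) : |s| ≤ |s₀| + 1 := by
  rw [Metric.mem_ball, Real.dist_eq] at h
  have := abs_add_le s₀ (s - s₀)
  rw [add_sub_cancel] at this
  linarith

lemma jt_hasDeriv {l a φ : ℝ} (hl : 0 < l) (ha : 0 < a) (s z : ℝ) :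
    HasDerivAt (fun s => jt l a φ s z) (djt l a φ s z) s := by
  unfold jt djt
  refine ((GG_hasDeriv l a s 1 z).const_mul φ).add (HasDerivAt.const_mul l ?_)
  refine (intervalIntegral.hasDerivAt_integral_of_dominated_loc_of_deriv_le
    (F := fun s v => s ^ 2 * GG l a s v z) (F' := fun s v => dH l a s v z)
    (bound := fun _ => (2 * (|s| + 1) + (|s| + 1) ^ 2) * DD l a (|s| + 1) z)
    (Metric.ball_mem_nhds s one_pos) ?_ ?_ ?_ ?_ ?_ ?_).2
  · refine Filter.Eventually.of_forall fun x => Continuous.aestronglyMeasurable ?_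
    unfold GG; fun_prop
  · apply Continuous.intervalIntegrable
    unfold GG; fun_prop
  · apply Continuous.aestronglyMeasurable
    unfold dH dG GG; fun_prop
  · refine Filter.Eventually.of_forall fun v hv x hx => ?_
    rw [Set.uIoc_of_le zero_le_one] at hv
    exact dH_bound hl ha (ball_abs hx) hv.1.le hv.2
  · simp
  · exact Filter.Eventually.of_forall fun v _ x _ => H_hasDeriv l a x v z

lemma djt_bound {l a φ R s : ℝ} (hl : 0 < l) (ha : 0 < a) (hφ : 0 ≤ φ) (hs : |s| ≤ R) (z : ℝ) :
    |djt l a φ s z| ≤ (φ + l * (2 * R + R ^ 2)) * DD l a R z := by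
  unfold djt
  refine (abs_add_le _ _).trans ?_
  rw [abs_mul, abs_mul, abs_of_nonneg hφ, abs_of_pos hl, add_mul]
  have h1 := dG_bound (z := z) hl ha hs zero_le_one le_rfl
  have h2 : |∫ v in (0:ℝ)..1, dH l a s v z| ≤ (2 * R + R ^ 2) * DD l a R z := by
    have := intervalIntegral.norm_integral_le_of_norm_le_const (a := 0) (b := 1)
      (f := fun v => dH l a s v z) (C := (2 * R + R ^ 2) * DD l a R z) (fun v hv => by
        rw [Set.uIoc_of_le zero_le_one] at hv
        exact dH_bound hl ha hs hv.1.le hv.2)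
    simpa using this
  rw [mul_assoc l]
  gcongr

lemma djt_int {l a φ : ℝ} (hl : 0 < l) (ha : 0 < a) (hφ : 0 ≤ φ) (s : ℝ) :
    Integrable (fun z => |djt l a φ s z| * gaussDensity z) := by
  refine ((DD_int l a |s|).const_mul (φ + l * (2 * |s| + |s| ^ 2))).mono'
    ((djt_cont l a φ s).abs.mul gd_cont).aestronglyMeasurable
    (Filter.Eventually.of_forall fun z => ?_)
  rw [Real.norm_eq_abs, abs_of_nonneg (mul_nonneg (abs_nonneg _) (gd_nonneg z)), ← mul_assoc]
  exact mul_le_mul_of_nonneg_right (djt_bound hl ha hφ le_rfl z) (gd_nonneg z)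

lemma dG_mean {l a s v : ℝ} (hl : 0 < l) (ha : 0 < a) (hs : 0 < s) (hv : 0 ≤ v) :
    ∫ z, |dG l a s v z| * gaussDensity z ≤
      Real.exp (l * s ^ 2 * v) * (2 * l * s * v + a * v * Real.sqrt (2 / Real.pi)) := by
  have h := gd_tilt (2 * l * s * v - a ^ 2 * s * v ^ 2) (a * v) (a * s * v)
  have h2 : 2 * l * s * v - a ^ 2 * s * v ^ 2 + a * v * (a * s * v) = 2 * l * s * v := by ring
  rw [h2, abs_of_nonneg (by positivity), abs_of_nonneg (by positivity)] at h
  refine le_trans (le_of_eq ?_) (mul_le_mul_of_nonneg_left h (Real.exp_pos (l * s ^ 2 * v)).le)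
  rw [← integral_const_mul]
  refine integral_congr_ae (Filter.Eventually.of_forall fun z => ?_)
  simp only
  unfold dG GG
  rw [abs_mul, Real.abs_exp,
    show l * s ^ 2 * v + a * z * s * v - a ^ 2 * s ^ 2 * v ^ 2 / 2 =
      l * s ^ 2 * v + (a * s * v * z - (a * s * v) ^ 2 / 2) by ring, Real.exp_add,
    show 2 * l * s * v + a * z * v - a ^ 2 * s * v ^ 2 =
      2 * l * s * v - a ^ 2 * s * v ^ 2 + a * v * z by ring]
  ring

lemma dH_mean {l a s v : ℝ} (hl : 0 < l) (ha : 0 < a) (hs : 0 < s) (hv : 0 ≤ v) :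
    ∫ z, |dH l a s v z| * gaussDensity z ≤
      Real.exp (l * s ^ 2 * v) *
        (2 * s + 2 * l * s ^ 3 * v + s ^ 2 * a * v * Real.sqrt (2 / Real.pi)) := by
  have h := gd_tilt (2 * s + s ^ 2 * (2 * l * s * v - a ^ 2 * s * v ^ 2)) (s ^ 2 * a * v) (a * s * v)
  have h2 : 2 * s + s ^ 2 * (2 * l * s * v - a ^ 2 * s * v ^ 2) + s ^ 2 * a * v * (a * s * v)
    = 2 * s + 2 * l * s ^ 3 * v := by ring
  rw [h2, abs_of_nonneg (by positivity), abs_of_nonneg (by positivity)] at h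
  refine le_trans (le_of_eq ?_) (mul_le_mul_of_nonneg_left h (Real.exp_pos (l * s ^ 2 * v)).le)
  rw [← integral_const_mul]
  refine integral_congr_ae (Filter.Eventually.of_forall fun z => ?_)
  simp only
  have e : dH l a s v z = GG l a s v z *
      (2 * s + s ^ 2 * (2 * l * s * v - a ^ 2 * s * v ^ 2) + s ^ 2 * a * v * z) := by
    unfold dH dG; ring
  rw [e]
  unfold GG
  rw [abs_mul, Real.abs_exp,
    show l * s ^ 2 * v + a * z * s * v - a ^ 2 * s ^ 2 * v ^ 2 / 2 =
      l * s ^ 2 * v + (a * s * v * z - (a * s * v) ^ 2 / 2) by ring, Real.exp_add]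
  ring

lemma djt_mean {l a φ s : ℝ} (hl : 0 < l) (ha : 0 < a) (hφ : 0 ≤ φ) (hs : 0 < s) :
    ∫ z, |djt l a φ s z| * gaussDensity z ≤
      Real.exp (l * s ^ 2) * (φ * (2 * l * s + a * Real.sqrt (2 / Real.pi)) +
        (2 * l * s + a * Real.sqrt (2 / Real.pi))) := by
  set C := Real.sqrt (2 / Real.pi) with hC
  have hC0 : 0 ≤ C := Real.sqrt_nonneg _
  -- joint integrability
  have hprod : Integrable (fun p : ℝ × ℝ => |dH l a s p.1 p.2| * gaussDensity p.2)
      ((volume.restrict (Set.Ioc (0:ℝ) 1)).prod volume) := by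
    have hb : Integrable (fun p : ℝ × ℝ => (2 * |s| + |s| ^ 2) *
        (DD l a |s| p.2 * gaussDensity p.2))
        ((volume.restrict (Set.Ioc (0:ℝ) 1)).prod volume) := by
      have h1 : Integrable (fun _ : ℝ => (2 * |s| + |s| ^ 2))
        (volume.restrict (Set.Ioc (0:ℝ) 1)) := integrable_const _
      exact h1.mul_prod (DD_int l a |s|)
    refine hb.mono' ?_ ?_
    · exact ((dH_cont l a s).abs.mul (gd_cont.comp continuous_snd)).aestronglyMeasurable
    · have hmem : ∀ᵐ p ∂((volume.restrict (Set.Ioc (0:ℝ) 1)).prod (volume : Measure ℝ)),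
          p.1 ∈ Set.Ioc (0:ℝ) 1 := by
        have := ae_restrict_mem (μ := (volume : Measure ℝ)) (measurableSet_Ioc (a := (0:ℝ)) (b := 1))
        exact Measure.quasiMeasurePreserving_fst.ae this
      filter_upwards [hmem] with p hp
      rw [Real.norm_eq_abs, abs_of_nonneg (mul_nonneg (abs_nonneg _) (gd_nonneg _)), ← mul_assoc]
      exact mul_le_mul_of_nonneg_right (dH_bound hl ha le_rfl hp.1.le hp.2) (gd_nonneg _)
  have hdG : Integrable (fun z => |dG l a s 1 z| * gaussDensity z) := by
    refine (DD_int l a |s|).mono' ?_ (Filter.Eventually.of_forall fun z => ?_)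
    · refine Continuous.aestronglyMeasurable (Continuous.mul ?_ gd_cont)
      unfold dG GG; fun_prop
    · rw [Real.norm_eq_abs, abs_of_nonneg (mul_nonneg (abs_nonneg _) (gd_nonneg _))]
      exact mul_le_mul_of_nonneg_right (dG_bound hl ha le_rfl zero_le_one le_rfl) (gd_nonneg _)
  have hI : Integrable (fun z => ∫ v in Set.Ioc (0:ℝ) 1, |dH l a s v z| * gaussDensity z) :=
    hprod.integral_prod_right
  have hIv : Integrable (fun v => ∫ z, |dH l a s v z| * gaussDensity z)
      (volume.restrict (Set.Ioc (0:ℝ) 1)) := hprod.integral_prod_left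
  have step1 : ∫ z, |djt l a φ s z| * gaussDensity z ≤
      ∫ z, (φ * (|dG l a s 1 z| * gaussDensity z) +
        l * ∫ v in Set.Ioc (0:ℝ) 1, |dH l a s v z| * gaussDensity z) := by
    refine integral_mono (djt_int hl ha hφ s) ((hdG.const_mul φ).add (hI.const_mul l)) fun z => ?_
    simp only
    rw [integral_mul_const, ← mul_assoc, ← mul_assoc, ← add_mul]
    refine mul_le_mul_of_nonneg_right ?_ (gd_nonneg z)
    unfold djt
    refine (abs_add_le _ _).trans ?_
    rw [abs_mul, abs_mul, abs_of_nonneg hφ, abs_of_pos hl,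
      intervalIntegral.integral_of_le zero_le_one]
    have := abs_integral_le_integral_abs (f := fun v => dH l a s v z)
      (μ := volume.restrict (Set.Ioc (0:ℝ) 1))
    gcongr
  refine step1.trans ?_
  rw [integral_add (hdG.const_mul φ) (hI.const_mul l), integral_const_mul, integral_const_mul]
  have hswap : ∫ z, ∫ v in Set.Ioc (0:ℝ) 1, |dH l a s v z| * gaussDensity z =
      ∫ v in Set.Ioc (0:ℝ) 1, ∫ z, |dH l a s v z| * gaussDensity z :=
    (integral_integral_swap (f := fun v z => |dH l a s v z| * gaussDensity z) hprod).symm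
  rw [hswap, ← integral_const_mul l]
  have m1 := dG_mean (l := l) (a := a) (s := s) (v := 1) hl ha hs zero_le_one
  simp only [mul_one] at m1
  -- the primitive
  let F : ℝ → ℝ := fun v => (2 * l * s * v + a * C) * Real.exp (l * s ^ 2 * v)
  let F' : ℝ → ℝ := fun v => (2 * l * s) * Real.exp (l * s ^ 2 * v) +
    (2 * l * s * v + a * C) * (Real.exp (l * s ^ 2 * v) * (l * s ^ 2))
  have hF : ∀ v, HasDerivAt F (F' v) v := by
    intro v
    have e1 : HasDerivAt (fun v : ℝ => 2 * l * s * v + a * C) (2 * l * s) v := by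
      simpa using ((hasDerivAt_id v).const_mul (2 * l * s)).add_const (a * C)
    have e2 : HasDerivAt (fun v : ℝ => l * s ^ 2 * v) (l * s ^ 2) v := by
      simpa using (hasDerivAt_id v).const_mul (l * s ^ 2)
    exact e1.mul e2.exp
  have hF'c : Continuous F' := by fun_prop
  have hFint : ∫ v in Set.Ioc (0:ℝ) 1, F' v = F 1 - F 0 := by
    rw [← intervalIntegral.integral_of_le zero_le_one]
    exact intervalIntegral.integral_eq_sub_of_hasDerivAt (fun v _ => hF v)
      (hF'c.intervalIntegrable _ _)
  have m2 : ∫ v in Set.Ioc (0:ℝ) 1, l * ∫ z, |dH l a s v z| * gaussDensity z ≤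
      ∫ v in Set.Ioc (0:ℝ) 1, F' v := by
    refine setIntegral_mono_on (hIv.const_mul l) ?_ measurableSet_Ioc fun v hv => ?_
    · exact (hF'c.integrableOn_Icc).mono_set Set.Ioc_subset_Icc_self
    · have := dH_mean (l := l) (a := a) (s := s) (v := v) hl ha hs hv.1.le
      have hE := Real.exp_pos (l * s ^ 2 * v)
      have hx : 0 ≤ l * s ^ 2 * a * C * Real.exp (l * s ^ 2 * v) := by positivity
      calc _ ≤ l * (Real.exp (l * s ^ 2 * v) *
            (2 * s + 2 * l * s ^ 3 * v + s ^ 2 * a * v * C)) := by gcongr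
        _ ≤ _ := by
          simp only [F']
          nlinarith [mul_nonneg hx (sub_nonneg.2 hv.2)]
  have hF1 : F 1 = (2 * l * s + a * C) * Real.exp (l * s ^ 2) := by simp [F]
  have hF0 : 0 ≤ F 0 := by simp only [F]; positivity
  have m3 := mul_le_mul_of_nonneg_left m1 hφ
  rw [hFint, hF1] at m2
  linarith

lemma jfun_eq {lam alp t φ z : ℝ} (ht : 0 < t) :
    jfun lam alp t φ z = jt lam alp φ (Real.sqrt t) z := by
  have hs0 : 0 < Real.sqrt t := Real.sqrt_pos.2 ht
  have hss : Real.sqrt t ^ 2 = t := Real.sq_sqrt ht.le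
  unfold jfun jt GG
  generalize Real.sqrt t = s at hs0 hss ⊢
  subst hss
  congr 1
  · rw [mul_comm]; ring_nf
  · have h := intervalIntegral.mul_integral_comp_mul_left (a := 0) (b := 1) (c := s ^ 2)
      (f := fun u => lam * Real.exp ((lam + alp * z / s) * u - alp ^ 2 * u ^ 2 / (2 * s ^ 2)))
    rw [mul_zero, mul_one] at h
    rw [← h, ← intervalIntegral.integral_const_mul, ← intervalIntegral.integral_const_mul]
    refine intervalIntegral.integral_congr fun v _ => ?_
    have : (lam + alp * z / s) * (s ^ 2 * v) - alp ^ 2 * (s ^ 2 * v) ^ 2 / (2 * s ^ 2) =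
      lam * s ^ 2 * v + alp * z * s * v - alp ^ 2 * s ^ 2 * v ^ 2 / 2 := by
      field_simp
    rw [this]; ring

lemma Kop_bound {lam alp c : ℝ} (hlam : 0 < lam) {w : ℝ → ℝ}
    (hwb : ∀ x : ℝ, 0 ≤ x → |w x| ≤ 1 / c) {φ t : ℝ} (hφ : 0 ≤ φ) (ht : 0 < t) :
    |Kop lam alp w t φ| ≤ 1 / c := by
  unfold Kop
  have h := norm_integral_le_of_norm_le (gd_int.const_mul (1 / c))
    (f := fun z => w (jfun lam alp t φ z) * gaussDensity z)
    (Filter.Eventually.of_forall fun z => by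
      rw [norm_mul, Real.norm_eq_abs, Real.norm_eq_abs, abs_of_nonneg (gd_nonneg z)]
      refine mul_le_mul_of_nonneg_right (hwb _ ?_) (gd_nonneg z)
      rw [jfun_eq ht]; exact jt_nonneg _ _ _ hlam hφ)
  rw [integral_const_mul, gd_total, mul_one] at h
  exact h

lemma k_hasDeriv {lam alp c L : ℝ} (hlam : 0 < lam) (halp : 0 < alp)
    {w : ℝ → ℝ} (hw : ContDiff ℝ 1 w)
    (hwb : ∀ x : ℝ, 0 ≤ x → |w x| ≤ 1 / c)
    (hwd : ∀ x : ℝ, 0 ≤ x → |deriv w x| ≤ L) {φ : ℝ} (hφ : 0 ≤ φ) (s : ℝ) :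
    HasDerivAt (fun s => ∫ z, w (jt lam alp φ s z) * gaussDensity z)
      (∫ z, deriv w (jt lam alp φ s z) * djt lam alp φ s z * gaussDensity z) s := by
  have hL : 0 ≤ L := (abs_nonneg _).trans (hwd 0 le_rfl)
  have hwc : Continuous w := hw.continuous
  have hwdc : Continuous (deriv w) := hw.continuous_deriv le_rfl
  have hdw : Differentiable ℝ w := hw.differentiable one_ne_zero
  refine (hasDerivAt_integral_of_dominated_loc_of_deriv_le
    (F := fun s z => w (jt lam alp φ s z) * gaussDensity z)
    (F' := fun s z => deriv w (jt lam alp φ s z) * djt lam alp φ s z * gaussDensity z)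
    (bound := fun z => (L * (φ + lam * (2 * (|s| + 1) + (|s| + 1) ^ 2))) *
      (DD lam alp (|s| + 1) z * gaussDensity z))
    (Metric.ball_mem_nhds s one_pos) ?_ ?_ ?_ ?_ ?_ ?_).2
  · exact Filter.Eventually.of_forall fun x =>
      ((hwc.comp (jt_cont lam alp φ x)).mul gd_cont).aestronglyMeasurable
  · refine (gd_int.const_mul (1 / c)).mono'
      ((hwc.comp (jt_cont lam alp φ s)).mul gd_cont).aestronglyMeasurable
      (Filter.Eventually.of_forall fun z => ?_)
    rw [norm_mul, Real.norm_eq_abs, Real.norm_eq_abs, abs_of_nonneg (gd_nonneg z)]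
    exact mul_le_mul_of_nonneg_right (hwb _ (jt_nonneg _ _ _ hlam hφ)) (gd_nonneg z)
  · exact (((hwdc.comp (jt_cont lam alp φ s)).mul (djt_cont lam alp φ s)).mul
      gd_cont).aestronglyMeasurable
  · refine Filter.Eventually.of_forall fun z x hx => ?_
    rw [norm_mul, norm_mul, Real.norm_eq_abs, Real.norm_eq_abs, Real.norm_eq_abs,
      abs_of_nonneg (gd_nonneg z), ← mul_assoc, mul_assoc L]
    refine mul_le_mul_of_nonneg_right ?_ (gd_nonneg z)
    exact mul_le_mul (hwd _ (jt_nonneg _ _ _ hlam hφ)) (djt_bound hlam halp hφ (ball_abs hx) z)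
      (abs_nonneg _) hL
  · exact (DD_int lam alp (|s| + 1)).const_mul _
  · refine Filter.Eventually.of_forall fun z x _ => ?_
    exact ((hdw _).hasDerivAt.comp x (jt_hasDeriv hlam halp x z)).mul_const _

lemma dk_bound {lam alp L : ℝ} (hlam : 0 < lam) (halp : 0 < alp)
    {w : ℝ → ℝ}
    (hwd : ∀ x : ℝ, 0 ≤ x → |deriv w x| ≤ L) {φ s : ℝ} (hφ : 0 ≤ φ) (hs : 0 < s) :
    |∫ z, deriv w (jt lam alp φ s z) * djt lam alp φ s z * gaussDensity z| ≤
      L * (Real.exp (lam * s ^ 2) * (φ * (2 * lam * s + alp * Real.sqrt (2 / Real.pi)) +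
        (2 * lam * s + alp * Real.sqrt (2 / Real.pi)))) := by
  have hL : 0 ≤ L := (abs_nonneg _).trans (hwd 0 le_rfl)
  have h := norm_integral_le_of_norm_le ((djt_int hlam halp hφ s).const_mul L)
    (f := fun z => deriv w (jt lam alp φ s z) * djt lam alp φ s z * gaussDensity z)
    (Filter.Eventually.of_forall fun z => by
      rw [norm_mul, norm_mul, Real.norm_eq_abs, Real.norm_eq_abs, Real.norm_eq_abs,
        abs_of_nonneg (gd_nonneg z), mul_assoc]
      exact mul_le_mul_of_nonneg_right (hwd _ (jt_nonneg _ _ _ hlam hφ))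
        (mul_nonneg (abs_nonneg _) (gd_nonneg z)))
  rw [integral_const_mul] at h
  exact h.trans (mul_le_mul_of_nonneg_left (djt_mean hlam halp hφ hs) hL)

lemma Jop_hasDeriv {lam alp c L : ℝ} (hlam : 0 < lam) (halp : 0 < alp)
    {w : ℝ → ℝ} (hw : ContDiff ℝ 1 w)
    (hwb : ∀ x : ℝ, 0 ≤ x → |w x| ≤ 1 / c)
    (hwd : ∀ x : ℝ, 0 ≤ x → |deriv w x| ≤ L) {φ t : ℝ} (hφ : 0 ≤ φ) (ht : 0 < t) :
    HasDerivAt (fun s => Jop lam alp c w s φ)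
      (Real.exp (-(lam * t)) * (varphi lam t φ - lam / c) +
        ((-lam * Real.exp (-(lam * t))) * Kop lam alp w t φ +
          Real.exp (-(lam * t)) * ((∫ z, deriv w (jt lam alp φ (Real.sqrt t) z) *
            djt lam alp φ (Real.sqrt t) z * gaussDensity z) * (1 / (2 * Real.sqrt t))))) t := by
  have hcont : Continuous fun u => Real.exp (-(lam * u)) * (varphi lam u φ - lam / c) := by
    unfold varphi; fun_prop
  have h1 := intervalIntegral.integral_hasDerivAt_right (hcont.intervalIntegrable 0 t)
    hcont.aestronglyMeasurable.stronglyMeasurableAtFilter hcont.continuousAt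
  have hk := (k_hasDeriv hlam halp hw hwb hwd hφ (Real.sqrt t)).comp t
    (Real.hasDerivAt_sqrt ht.ne')
  have hK : HasDerivAt (fun s => Kop lam alp w s φ) _ t := hk.congr_of_eventuallyEq (by
    filter_upwards [lt_mem_nhds ht] with x hx
    unfold Kop
    simp only [Function.comp, jfun_eq hx])
  have hE : HasDerivAt (fun s => Real.exp (-(lam * s))) (-lam * Real.exp (-(lam * t))) t := by
    have e : HasDerivAt (fun s : ℝ => -(lam * s)) (-lam) t := by
      simpa using (hasDerivAt_id t).const_mul (-lam)
    simpa [mul_comm] using e.exp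
  refine (h1.add (hE.mul hK)).congr_of_eventuallyEq ?_
  filter_upwards [lt_mem_nhds ht] with x hx
  simp only [Jop, hx, if_true, Pi.add_apply, Pi.mul_apply]

/-- If `w` is continuously differentiable with `|w| ≤ 1/c` and `|w′| ≤ L` on `[0, ∞)`,
then for every `φ ≥ 0` the map `t ↦ J w(t, φ)` is differentiable on `(0, ∞)`, with
`|d/dt J w(t, φ)| ≤ φ + 1 + 2λ/c + L(φ((1/2)αC₁ t^{−1/2} + λ) + λ + (1/2)αC₁ t^{−1/2})`,
where `C₁ = √(2/π)`. -/
theorem Jop_time_deriv_bound (lam alp c : ℝ) (hlam : 0 < lam) (halp : 0 < alp) (hc : 0 < c)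
    (w : ℝ → ℝ) (hw : ContDiff ℝ 1 w) (L : ℝ)
    (hwb : ∀ x : ℝ, 0 ≤ x → |w x| ≤ 1 / c)
    (hwd : ∀ x : ℝ, 0 ≤ x → |deriv w x| ≤ L)
    (φ : ℝ) (hφ : 0 ≤ φ) :
    (∀ t : ℝ, 0 < t → DifferentiableAt ℝ (fun s : ℝ => Jop lam alp c w s φ) t) ∧
      ∀ t : ℝ, 0 < t →
        |deriv (fun s : ℝ => Jop lam alp c w s φ) t| ≤
          φ + 1 + 2 * lam / c +
            L * (φ * ((1 / 2) * alp * Real.sqrt (2 / Real.pi) / Real.sqrt t + lam) + lam +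
              (1 / 2) * alp * Real.sqrt (2 / Real.pi) / Real.sqrt t) := by
  have hd := fun t (ht : 0 < t) =>
    Jop_hasDeriv (c := c) hlam halp hw hwb hwd hφ ht
  refine ⟨fun t ht => (hd t ht).differentiableAt, fun t ht => ?_⟩
  rw [(hd t ht).deriv]
  set s := Real.sqrt t with hs
  have hs0 : 0 < s := Real.sqrt_pos.2 ht
  have hss : s ^ 2 = t := Real.sq_sqrt ht.le
  have hL : 0 ≤ L := (abs_nonneg _).trans (hwd 0 le_rfl)
  set C := Real.sqrt (2 / Real.pi) with hC
  have hE : Real.exp (-(lam * t)) * Real.exp (lam * t) = 1 := by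
    rw [← Real.exp_add]; simp
  have hE0 := Real.exp_pos (-(lam * t))
  have hE1 : Real.exp (-(lam * t)) ≤ 1 := Real.exp_le_one_iff.2 (by nlinarith [mul_pos hlam ht])
  set E := Real.exp (-(lam * t)) with hEdef
  have hlc : 0 ≤ lam / c := by positivity
  have b1 : |E * (varphi lam t φ - lam / c)| ≤ φ + 1 + lam / c := by
    have : E * (varphi lam t φ - lam / c) = (φ + 1) - E * (1 + lam / c) := by
      unfold varphi
      linear_combination (φ + 1) * hE
    rw [this, abs_le]
    have h1 : E * (lam / c) ≤ lam / c := mul_le_of_le_one_left hlc hE1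
    have h2 : 0 ≤ E * (lam / c) := by positivity
    constructor <;> nlinarith
  have b2 : |(-lam * E) * Kop lam alp w t φ| ≤ lam / c := by
    have h1 := Kop_bound (alp := alp) hlam hwb hφ ht
    rw [abs_mul, abs_mul, abs_neg, abs_of_pos hlam, abs_of_pos hE0]
    calc lam * E * |Kop lam alp w t φ| ≤ lam * 1 * (1 / c) := by gcongr
      _ = lam / c := by ring
  have b3 : |E * ((∫ z, deriv w (jt lam alp φ s z) * djt lam alp φ s z * gaussDensity z) *
      (1 / (2 * s)))| ≤ L * (φ * ((1 / 2) * alp * C / s + lam) + lam + (1 / 2) * alp * C / s) := by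
    have h1 := dk_bound (alp := alp) (w := w) hlam halp hwd hφ hs0
    rw [hss] at h1
    rw [abs_mul, abs_mul, abs_of_pos hE0, abs_of_pos (by positivity : 0 < 1 / (2 * s))]
    calc _ ≤ E * ((L * (Real.exp (lam * t) *
            (φ * (2 * lam * s + alp * C) + (2 * lam * s + alp * C)))) * (1 / (2 * s))) := by
          gcongr
      _ = (E * Real.exp (lam * t)) * (L * (φ * (2 * lam * s + alp * C) +
            (2 * lam * s + alp * C)) * (1 / (2 * s))) := by ring
      _ = _ := by
          rw [hE]
          field_simp
          ring
  have t1 := abs_add_le (E * (varphi lam t φ - lam / c))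
    ((-lam * E) * Kop lam alp w t φ +
      E * ((∫ z, deriv w (jt lam alp φ s z) * djt lam alp φ s z * gaussDensity z) *
      (1 / (2 * s))))
  have t2 := abs_add_le ((-lam * E) * Kop lam alp w t φ)
      (E * ((∫ z, deriv w (jt lam alp φ s z) * djt lam alp φ s z * gaussDensity z) *
      (1 / (2 * s))))
  have e : 2 * lam / c = lam / c + lam / c := by ring
  rw [e]
  linarith
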